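/- Let φ: S → R be a ring morphism, W ∈ S, X and Y finite rank matrix factorisations of φ(W) over R, and t = (t₁,…,tₙ) a quasi-regular sequence in R acting null-homotopically on both X and Y, with the hypotheses (chosen homotopies λⱼ, μⱼ and a deformation retract datum (σ, π, h) of K(t) onto R/tR over S with h² = 0, hσ = 0, πh = 0) under which the morphisms θ_X: X[n] → X/tX, ψ_X: X/tX → X[n] and θ_Y, ψ_Y are constructed, satisfying ψ_X θ_X = 1 and ψ_Y θ_Y = 1 up to homotopy and ψ natural. Then for any morphism α: X → Y of matrix factorisations over R, the square ψ_Y ∘ (α mod t) ∘ θ_X ≃ α[n] commutes up to homotopy over S; that is, ψ_Y ∘ ᾱ ∘ θ_X is homotopic to α[n], where ᾱ: X/tX → Y/tY is induced by α. -/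

import Mathlib

/-!
STATEMENT 5 (naturality: ψ_Y ∘ ᾱ ∘ θ_X ≃ α[n]).

Conventions as in the previous statements.  Finite rank matrix factorisations `X`, `Y`
of `φ(W)` over `R` with homogeneous bases are `ι → R`, `κ → R` with parity functions;
gradings `gX`, odd maps anticommute with them.  The Koszul complex `K(t)` on
`u : Fin n → R` is `Finset (Fin n) → R`; `(σ, π, h)` is a deformation retract datum of
ℤ-graded complexes over `S` contracting it onto `R/tR`, with `h² = 0`, `hσ = 0`,
`πh = 0`.  For a matrix factorisation with homotopies `λⱼ` one sets
`ψ = ε ∘ σ_∞ : X/tX → X[n]` (with `σ_∞ = Σ_{m ≤ n}(hd)^m σ`) and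
`θ = (-1)ⁿλ₁⋯λₙ : X[n] → X/tX`.  A morphism `α : X → Y` is an even `R`-linear chain
map; `ᾱ : X/tX → Y/tY` is its reduction and `α[n]` has the same underlying map, the
suspensions carrying the differentials `(-1)ⁿ d`.
-/

namespace Stmt5

open Finset

def IsQuasiRegular {R : Type*} [CommRing R] {n : ℕ} (u : Fin n → R) : Prop :=
  ∀ (k : ℕ) (F : MvPolynomial (Fin n) R), F.IsHomogeneous k →
    MvPolynomial.eval u F ∈ (Ideal.span (Set.range u)) ^ (k + 1) →
    ∀ m, MvPolynomial.coeff m F ∈ Ideal.span (Set.range u)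

abbrev KT (R : Type*) (n : ℕ) := Finset (Fin n) → R

def ksign (R : Type*) [CommRing R] {n : ℕ} (i : Fin n) (I : Finset (Fin n)) : R :=
  (-1 : R) ^ (I.filter (fun j => j < i)).card

def delK {R : Type*} [CommRing R] {n : ℕ} (u : Fin n → R) : Module.End R (KT R n) :=
  LinearMap.pi fun J =>
    ∑ i : Fin n,
      if i ∈ J then 0
      else (ksign R i J * u i) • LinearMap.proj (insert i J)

def gX (R : Type*) [CommRing R] {ι : Type*} [Fintype ι] [DecidableEq ι]
    (par : ι → Bool) : Module.End R (ι → R) :=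
  LinearMap.pi fun i => (if par i then (-1 : R) else 1) • LinearMap.proj i

/-- The (rectangular) matrix of a map `(ι → R) → (κ → R)`. -/
def amat {R : Type*} [CommRing R] {ι κ : Type*} [Fintype ι] [DecidableEq ι]
    (α : (ι → R) →ₗ[R] (κ → R)) (a : κ) (b : ι) : R :=
  α (Pi.single b 1) a

/-- Extension of a matrix over `R` to maps `(ι → M) → (κ → M)` (no sign). -/
def matExt {R M : Type*} [CommRing R] [AddCommGroup M] [Module R M]
    {ι κ : Type*} [Fintype ι] [DecidableEq ι] (A : κ → ι → R) :
    (ι → M) →ₗ[R] (κ → M) :=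
  LinearMap.pi fun a => ∑ b, A a b • LinearMap.proj b

def evExt (S : Type*) [CommRing S] {L M : Type*} [AddCommGroup L] [Module S L]
    [AddCommGroup M] [Module S M] {ι : Type*} (t : L →ₗ[S] M) :
    (ι → L) →ₗ[S] (ι → M) :=
  LinearMap.pi fun i => t ∘ₗ LinearMap.proj i

def oddExt (S : Type*) [CommRing S] {L M : Type*} [AddCommGroup L] [Module S L]
    [AddCommGroup M] [Module S M] {ι : Type*} (par : ι → Bool) (t : L →ₗ[S] M) :
    (ι → L) →ₗ[S] (ι → M) :=
  LinearMap.pi fun i =>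
    (if par i then (-1 : ℤ) else 1) • (t ∘ₗ LinearMap.proj i)

def epsX (R : Type*) [CommRing R] {ι : Type*} [Fintype ι] [DecidableEq ι]
    (par : ι → Bool) (n : ℕ) : (ι → KT R n) →ₗ[R] (ι → R) :=
  ((gX R par) ^ n) ∘ₗ
    (LinearMap.pi fun i =>
      (LinearMap.proj (univ : Finset (Fin n)) : KT R n →ₗ[R] R) ∘ₗ LinearMap.proj i)

end Stmt5

namespace Stmt5

section Extension

theorem matExt_amat_slice {R : Type*} [CommRing R] {ι κ : Type*} [Fintype ι] [DecidableEq ι]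
    (α : (ι → R) →ₗ[R] (κ → R)) {A : Type*} (F : ι → A → R) (J : A) :
    (fun a => (matExt (amat α) : (ι → A → R) →ₗ[R] (κ → A → R)) F a J)
      = α (fun b => F b J) := by
  funext a
  conv_rhs => rw [LinearMap.pi_apply_eq_sum_univ α]
  simp [matExt, amat, Finset.sum_apply, mul_comm, ← Pi.single_apply, Pi.single_comm]

theorem matExt_amat_self {R : Type*} [CommRing R] {ι κ : Type*} [Fintype ι] [DecidableEq ι]
    (α : (ι → R) →ₗ[R] (κ → R)) (x : ι → R) :
    (matExt (amat α) : (ι → R) →ₗ[R] (κ → R)) x = α x := by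
  funext a
  conv_rhs => rw [LinearMap.pi_apply_eq_sum_univ α]
  simp [matExt, amat, Finset.sum_apply, mul_comm, ← Pi.single_apply, Pi.single_comm]

theorem matExt_evExt {R : Type*} [CommRing R] {ι κ : Type*} [Fintype ι] [DecidableEq ι]
    {L M : Type*} [AddCommGroup L] [Module R L] [AddCommGroup M]
    [Module R M] (A : κ → ι → R) (t : L →ₗ[R] M) (F : ι → L) :
    (matExt A : (ι → M) →ₗ[R] (κ → M)) (evExt R t F) = evExt R t (matExt A F) := by
  funext a
  simp [matExt, evExt]

theorem ext_slice {R ι A : Type*} {F G : ι → A → R}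
    (hFG : ∀ J, (fun b => F b J) = fun b => G b J) : F = G := by
  funext b J
  exact congrFun (hFG J) b

theorem oddExt_apply {S : Type*} [CommRing S] {L M : Type*} [AddCommGroup L] [Module S L]
    [AddCommGroup M] [Module S M] {ι : Type*} (par : ι → Bool) (t : L →ₗ[S] M) (F : ι → L)
    (i : ι) : oddExt S par t F i = if par i then -t (F i) else t (F i) := by
  by_cases hi : par i <;> simp [oddExt, hi]

theorem oddExt_oddExt {S : Type*} [CommRing S] {L M N : Type*} [AddCommGroup L] [Module S L]
    [AddCommGroup M] [Module S M] [AddCommGroup N] [Module S N] {ι : Type*} (par : ι → Bool)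
    (t : M →ₗ[S] N) (t' : L →ₗ[S] M) :
    oddExt S par t ∘ₗ oddExt S par t' = evExt S (t ∘ₗ t') := by
  refine LinearMap.ext fun F => funext fun i => ?_
  simp only [LinearMap.comp_apply, oddExt_apply]
  split <;> simp [evExt]

theorem oddExt_mul_add {R : Type*} [CommRing R] {n : ℕ} {ι : Type*} (par : ι → Bool)
    {s t : Module.End R (KT R n)} {r : R}
    (hst : s * t + t * s = r • 1) :
    (oddExt R par s * oddExt R par t + oddExt R par t * oddExt R par s :
      Module.End R (ι → KT R n)) = r • 1 := by
  rw [Module.End.mul_eq_comp, Module.End.mul_eq_comp, oddExt_oddExt, oddExt_oddExt]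
  exact LinearMap.ext fun F => funext fun i => LinearMap.congr_fun hst (F i)

variable {R : Type*} [CommRing R] {ι : Type*} [Fintype ι] [DecidableEq ι]

theorem gX_apply (par : ι → Bool) (x : ι → R) (i : ι) :
    gX R par x i = if par i then -x i else x i := by
  simp only [gX, LinearMap.pi_apply]
  split <;> simp

theorem gX_mul_self (par : ι → Bool) : gX R par * gX R par = 1 := by
  refine LinearMap.ext fun x => funext fun i => ?_
  simp only [Module.End.mul_apply, gX_apply, Module.End.one_apply]
  split <;> simp

theorem gX_pow_mul_pow (par : ι → Bool) (k : ℕ) : gX R par ^ k * gX R par ^ k = 1 := by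
  rw [← (Commute.refl (gX R par)).mul_pow, gX_mul_self, one_pow]

theorem oddExt_slice {n : ℕ} (par : ι → Bool) (t : Module.End R (KT R n)) (F : ι → KT R n)
    (J : Finset (Fin n)) :
    (fun b => oddExt R par t F b J) = gX R par (fun b => t (F b) J) := by
  funext b
  rw [gX_apply, oddExt_apply]
  split <;> rfl

end Extension

section Koszul

variable {R : Type*} [CommRing R] {n : ℕ}

/-- Exterior multiplication by the `j`-th generator of the Koszul complex. -/
def wedge (R : Type*) [CommRing R] {n : ℕ} (j : Fin n) : Module.End R (KT R n) :=
  LinearMap.pi fun J =>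
    if j ∈ J then ksign R j (J.erase j) • LinearMap.proj (J.erase j) else 0

theorem wedge_apply (j : Fin n) (f : KT R n) (J : Finset (Fin n)) :
    wedge R j f J = if j ∈ J then ksign R j (J.erase j) * f (J.erase j) else 0 := by
  simp only [wedge, LinearMap.pi_apply]
  split <;> simp

theorem delK_apply (u : Fin n → R) (f : KT R n) (J : Finset (Fin n)) :
    delK u f J = ∑ i, if i ∈ J then 0 else ksign R i J * u i * f (insert i J) := by
  simp only [delK, LinearMap.pi_apply, LinearMap.sum_apply]
  refine Finset.sum_congr rfl fun i _ => ?_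
  split <;> simp

theorem ksign_mul_self (i : Fin n) (J : Finset (Fin n)) :
    ksign R i J * ksign R i J = 1 := by
  rw [ksign, ← mul_pow]; simp

theorem ksign_insert (i j : Fin n) {J : Finset (Fin n)} (hj : j ∉ J) :
    ksign R i (insert j J) = if j < i then -ksign R i J else ksign R i J := by
  unfold ksign
  rw [Finset.filter_insert]
  split
  · rw [Finset.card_insert_of_notMem (by simp [hj]), pow_succ]; ring
  · rfl

theorem delK_mul_wedge_add (u : Fin n → R) (j : Fin n) :
    delK u * wedge R j + wedge R j * delK u = u j • (1 : Module.End R (KT R n)) := by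
  refine LinearMap.ext fun f => funext fun J => ?_
  simp only [LinearMap.add_apply, Module.End.mul_apply, Pi.add_apply, LinearMap.smul_apply,
    Module.End.one_apply, Pi.smul_apply, smul_eq_mul]
  rw [delK_apply, wedge_apply]
  by_cases hj : j ∈ J
  · obtain ⟨I, hI, rfl⟩ : ∃ I, j ∉ I ∧ J = insert j I :=
      ⟨J.erase j, Finset.notMem_erase _ _, (Finset.insert_erase hj).symm⟩
    rw [if_pos hj, Finset.erase_insert hI, delK_apply, Finset.mul_sum, ← Finset.sum_add_distrib,
      Finset.sum_eq_single j]
    · rw [if_pos hj, if_neg hI]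
      linear_combination (u j * f (insert j I)) * ksign_mul_self (R := R) j I
    · intro i _ hij
      by_cases hi : i ∈ I
      · simp [hi]
      · have hi' : i ∉ insert j I := by simp [hi, hij]
        have hj' : j ∉ insert i I := by simp [hI, Ne.symm hij]
        rw [if_neg hi', if_neg hi, wedge_apply, if_pos (by simp), Finset.insert_comm,
          Finset.erase_insert hj', ksign_insert i j hI, ksign_insert j i hi]
        rcases lt_or_gt_of_ne hij with hlt | hlt
        · rw [if_neg hlt.not_gt, if_pos hlt]; ring
        · rw [if_pos hlt, if_neg hlt.not_gt]; ring
    · simp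
  · rw [if_neg hj, add_zero, Finset.sum_eq_single j]
    · rw [if_neg hj, wedge_apply, if_pos (by simp), Finset.erase_insert hj]
      linear_combination (u j * f J) * ksign_mul_self (R := R) j J
    · intro i _ hij
      rw [wedge_apply, if_neg (c := j ∈ insert i J) (by simp [hj, Ne.symm hij])]
      simp
    · simp

/-- A map of degree one on the Koszul complex raises the filtration by degree. -/
theorem vanish_card_lt_succ {S : Type*} [CommRing S] [Algebra S R] (h : KT R n →ₗ[S] KT R n)
    (hh : ∀ (k : ℕ) (f : KT R n), (∀ I, I.card ≠ k → f I = 0) → ∀ J, J.card ≠ k + 1 → h f J = 0)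
    {m : ℕ} {f : KT R n} (hf : ∀ I : Finset (Fin n), I.card < m → f I = 0)
    {J : Finset (Fin n)} (hJ : J.card < m + 1) : h f J = 0 := by
  have hsum : f = ∑ k ∈ Finset.range (n + 1), fun I => if I.card = k then f I else 0 := by
    funext I
    rw [Finset.sum_apply, Finset.sum_ite_eq, if_pos]
    simpa [Nat.lt_succ_iff] using I.card_le_univ
  rw [hsum, map_sum, Finset.sum_apply]
  refine Finset.sum_eq_zero fun k _ => ?_
  by_cases hk : J.card = k + 1
  · have : (fun I : Finset (Fin n) => if I.card = k then f I else 0) = 0 := by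
      funext I
      split
      · exact hf I (by omega)
      · rfl
    rw [this, map_zero, Pi.zero_apply]
  · exact hh k _ (fun I hI => if_neg hI) J hk

end Koszul

/-- The homological perturbation lemma for a square-zero homotopy, in a ring. -/
theorem perturbation_identity {A : Type*} [Ring A] {d δ h p w : A} {N : ℕ}
    (hN : (h * d) ^ N = 0) (hh : h * h = 0) (hdd : d * d = w) (hw : Commute w h)
    (hdδ : d * δ = -(δ * d)) (hp : p = 1 + (δ * h + h * δ)) (hpdh : p * d * h = 0) :
    (∑ m ∈ Finset.range N, (h * d) ^ m) * p =
      1 + ((d + δ) * ((∑ m ∈ Finset.range N, (h * d) ^ m) * h) +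
        (∑ m ∈ Finset.range N, (h * d) ^ m) * h * (d + δ)) := by
  set G := ∑ m ∈ Finset.range N, (h * d) ^ m with hG
  have hl : G * (1 - h * d) = 1 := by rw [hG, geom_sum_mul_neg, hN, sub_zero]
  have hr : (1 - h * d) * G = 1 := by rw [hG, mul_neg_geom_sum, hN, sub_zero]
  have hGh : G * h = h + h * (d * (G * h)) := by
    have := congrArg (· * h) hr
    simp only [sub_mul, one_mul, mul_assoc] at this
    exact sub_eq_iff_eq_add.mp this
  have hpG : p * d * (G * h) = 0 := by
    rw [hGh, mul_add, hpdh, ← mul_assoc, hpdh, zero_mul, zero_add]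
  have hhG : h * (G * h) = 0 := by
    rw [hGh, mul_add, hh, ← mul_assoc, hh, zero_mul, zero_add]
  have hD : (1 - h * d) * (d + δ) = δ * (1 - h * d) + p * d - w * h := by
    have h₁ : h * d * d = w * h := by rw [mul_assoc, hdd, hw.eq]
    have h₂ : h * d * δ = -(h * δ * d) := by rw [mul_assoc, hdδ, mul_neg, mul_assoc]
    rw [mul_add, sub_mul, sub_mul, h₁, h₂, hp]
    noncomm_ring
  have key : p = (1 - h * d) + (1 - h * d) * (d + δ) * (G * h) + h * (d + δ) := by
    have h₁ : δ * (1 - h * d) * (G * h) = δ * h := by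
      rw [mul_assoc, ← mul_assoc (1 - h * d), hr, one_mul]
    rw [hD, sub_mul, add_mul, h₁, hpG, mul_assoc w, hhG, hp]
    noncomm_ring
  calc G * p = G * (1 - h * d) + G * (1 - h * d) * ((d + δ) * (G * h)) + G * h * (d + δ) := by
        conv_lhs => rw [key]
        noncomm_ring
    _ = _ := by rw [hl, one_mul, add_assoc]

theorem add_mul_sub_anticomm {A : Type*} [Ring A] {d l δ w r : A} (hld : l * d + d * l = r)
    (hδw : δ * w + w * δ = r) (hdw : d * w = -(w * d)) (hlδ : l * δ = -(δ * l)) :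
    (d + δ) * (l - w) = -((l - w) * (d + δ)) := by
  have h₁ : d * l = r - l * d := eq_sub_of_add_eq' hld
  have h₂ : δ * w = r - w * δ := eq_sub_of_add_eq hδw
  rw [add_mul, mul_sub, mul_sub, sub_mul, mul_add, mul_add, h₁, h₂, hdw, hlδ]
  abel

theorem list_prod_apply_of_anticomm {R M : Type*} [CommRing R] [AddCommGroup M] [Module R M]
    {D : Module.End R M} (l : List (Module.End R M)) (hl : ∀ P ∈ l, ∀ x, D (P x) = -P (D x))
    (x : M) : D (l.prod x) = (-1 : R) ^ l.length • l.prod (D x) := by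
  induction l with
  | nil => simp
  | cons P l ih =>
    simp only [List.mem_cons, forall_eq_or_imp] at hl
    rw [List.prod_cons, Module.End.mul_apply, hl.1, ih hl.2, map_smul, List.length_cons, pow_succ,
      mul_neg_one, neg_smul, Module.End.mul_apply]

section Total

variable {R : Type*} [CommRing R] {n : ℕ} {ι : Type*} [Fintype ι] [DecidableEq ι]

/-- The inclusion `X → X ⊗ K(t)` in Koszul degree zero. -/
def inclZero (R : Type*) [CommRing R] (ι : Type*) (n : ℕ) : (ι → R) →ₗ[R] (ι → KT R n) :=
  LinearMap.pi fun i => LinearMap.single R (fun _ => R) ∅ ∘ₗ LinearMap.proj i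

/-- The differential on `X ⊗ K(t)`. -/
def totalD (par : ι → Bool) (d : Module.End R (ι → R)) (u : Fin n → R) :
    Module.End R (ι → KT R n) :=
  matExt (amat d) + oddExt R par (delK u)

/-- The difference on `X ⊗ K(t)` of the two null-homotopies of `tⱼ`. -/
def closedOp (par : ι → Bool) (l : Module.End R (ι → R)) (j : Fin n) :
    Module.End R (ι → KT R n) :=
  matExt (amat l) - oddExt R par (wedge R j)

theorem matExt_amat_mul (α β : Module.End R (ι → R)) :
    (matExt (amat α) * matExt (amat β) : Module.End R (ι → KT R n)) = matExt (amat (α * β)) := by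
  refine LinearMap.ext fun F => ext_slice fun J => ?_
  rw [Module.End.mul_apply, matExt_amat_slice, matExt_amat_slice, matExt_amat_slice,
    Module.End.mul_apply]

theorem matExt_amat_smul_one (r : R) :
    (matExt (amat (r • 1 : Module.End R (ι → R))) : Module.End R (ι → KT R n)) = r • 1 := by
  refine LinearMap.ext fun F => ext_slice fun J => ?_
  rw [matExt_amat_slice]
  rfl

theorem matExt_amat_add (α β : Module.End R (ι → R)) :
    (matExt (amat (α + β)) : Module.End R (ι → KT R n)) =
      matExt (amat α) + matExt (amat β) := by
  refine LinearMap.ext fun F => ext_slice fun J => ?_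
  rw [matExt_amat_slice, LinearMap.add_apply, LinearMap.add_apply, ← matExt_amat_slice,
    ← matExt_amat_slice]
  rfl

theorem matExt_amat_neg (α : Module.End R (ι → R)) :
    (matExt (amat (-α)) : Module.End R (ι → KT R n)) = -matExt (amat α) := by
  refine LinearMap.ext fun F => ext_slice fun J => ?_
  rw [matExt_amat_slice, LinearMap.neg_apply, LinearMap.neg_apply, ← matExt_amat_slice]
  rfl

theorem oddExt_eq (par : ι → Bool) (t : Module.End R (KT R n)) :
    oddExt R par t = (evExt R t : Module.End R (ι → KT R n)) * matExt (amat (gX R par)) := by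
  refine LinearMap.ext fun F => ext_slice fun J => ?_
  rw [oddExt_slice, Module.End.mul_apply, ← matExt_evExt, matExt_amat_slice]
  rfl

theorem matExt_oddExt_anticomm {par : ι → Bool} {d : Module.End R (ι → R)}
    (hd : d * gX R par = -(gX R par * d)) (t : Module.End R (KT R n)) :
    (matExt (amat d) * oddExt R par t : Module.End R (ι → KT R n)) =
      -(oddExt R par t * matExt (amat d)) := by
  have hc : (matExt (amat d) * evExt R t : Module.End R (ι → KT R n)) =
      evExt R t * matExt (amat d) := LinearMap.ext fun F => matExt_evExt _ _ _
  rw [oddExt_eq, ← mul_assoc, hc, mul_assoc, mul_assoc, matExt_amat_mul, matExt_amat_mul, hd,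
    matExt_amat_neg]
  exact LinearMap.comp_neg _ _

theorem totalD_mul_closedOp {par : ι → Bool} {d l : Module.End R (ι → R)} {u : Fin n → R}
    {j : Fin n} (hd : d * gX R par = -(gX R par * d)) (hl : l * gX R par = -(gX R par * l))
    (hld : l * d + d * l = u j • (1 : Module.End R (ι → R))) :
    totalD par d u * closedOp par l j = -(closedOp par l j * totalD par d u) := by
  have h₁ := congrArg (fun z => (matExt (amat z) : Module.End R (ι → KT R n))) hld
  simp only [matExt_amat_add, matExt_amat_smul_one, ← matExt_amat_mul] at h₁
  have h₂ := oddExt_mul_add par (delK_mul_wedge_add u j)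
  have h₃ := matExt_oddExt_anticomm hd (wedge R j)
  have h₄ := matExt_oddExt_anticomm hl (delK u)
  exact add_mul_sub_anticomm h₁ h₂ h₃ h₄

theorem closedOp_slice (par : ι → Bool) (l : Module.End R (ι → R)) (j : Fin n)
    (F : ι → KT R n) (J : Finset (Fin n)) :
    (fun b => closedOp par l j F b J) =
      l (fun b => F b J) - gX R par (fun b => wedge R j (F b) J) := by
  rw [← oddExt_slice, ← matExt_amat_slice]
  rfl

theorem closedOp_prod_slice_empty (par : ι → Bool) (lam : Fin n → Module.End R (ι → R))
    (l : List (Fin n)) (x : ι → R) :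
    (fun b => (l.map fun j => closedOp par (lam j) j).prod (inclZero R ι n x) b ∅) =
      (l.map lam).prod x := by
  induction l with
  | nil => simp [inclZero]
  | cons j l ih =>
    rw [List.map_cons, List.prod_cons, Module.End.mul_apply, closedOp_slice, ih]
    simp [wedge_apply, ← Pi.zero_def]

theorem closedOp_prod_slice_of_not_subset (par : ι → Bool) (lam : Fin n → Module.End R (ι → R))
    (l : List (Fin n)) (x : ι → R) (J : Finset (Fin n)) (hJ : ¬ J ⊆ l.toFinset) :
    (fun b => (l.map fun j => closedOp par (lam j) j).prod (inclZero R ι n x) b J) = 0 := by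
  induction l generalizing J with
  | nil =>
    have : J ≠ ∅ := by rintro rfl; simp at hJ
    funext b
    simp [inclZero, this]
  | cons j l ih =>
    rw [List.toFinset_cons, Finset.subset_insert_iff] at hJ
    rw [List.map_cons, List.prod_cons, Module.End.mul_apply, closedOp_slice,
      ih J fun hs => hJ ((Finset.erase_subset _ _).trans hs), map_zero, zero_sub, neg_eq_zero]
    convert map_zero (gX R par) using 2
    funext b
    rw [wedge_apply, congrFun (ih _ hJ) b]
    simp

theorem closedOp_prod_slice_toFinset (par : ι → Bool) (lam : Fin n → Module.End R (ι → R))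
    (l : List (Fin n)) (hl : l.Pairwise (· < ·)) (x : ι → R) :
    (fun b => (l.map fun j => closedOp par (lam j) j).prod (inclZero R ι n x) b l.toFinset) =
      (-1 : R) ^ l.length • (gX R par ^ l.length) x := by
  induction l with
  | nil => simp [inclZero]
  | cons j l ih =>
    rw [List.pairwise_cons] at hl
    have hj : j ∉ l.toFinset := fun hj => (hl.1 j (by simpa using hj)).false
    have hs : ksign R j l.toFinset = 1 := by
      rw [ksign, Finset.filter_false_of_mem, Finset.card_empty, pow_zero]
      exact fun i hi => (hl.1 i (by simpa using hi)).not_gt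
    rw [List.map_cons, List.prod_cons, Module.End.mul_apply, closedOp_slice,
      closedOp_prod_slice_of_not_subset par lam l x _
        (fun hs => hj (hs (by simp))), map_zero, zero_sub]
    simp only [wedge_apply, List.toFinset_cons, Finset.mem_insert_self, if_true,
      Finset.erase_insert hj, hs, one_mul]
    rw [ih hl.2, List.length_cons, pow_succ, pow_succ', Module.End.mul_apply, map_smul]
    simp

/-- The closed lift `X[n] → X ⊗ K(t)` of `λ₁⋯λₙ`. -/
def closedLift (par : ι → Bool) (lam : Fin n → Module.End R (ι → R)) :
    (ι → R) →ₗ[R] (ι → KT R n) :=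
  ((List.finRange n).map fun j => closedOp par (lam j) j).prod ∘ₗ inclZero R ι n

theorem closedLift_slice_empty (par : ι → Bool) (lam : Fin n → Module.End R (ι → R))
    (x : ι → R) : (fun b => closedLift par lam x b ∅) = (List.ofFn lam).prod x := by
  rw [List.ofFn_eq_map]
  exact closedOp_prod_slice_empty par lam _ x

theorem closedLift_slice_univ (par : ι → Bool) (lam : Fin n → Module.End R (ι → R))
    (x : ι → R) :
    (fun b => closedLift par lam x b Finset.univ) = (-1 : R) ^ n • (gX R par ^ n) x := by
  simpa [closedLift] using closedOp_prod_slice_toFinset par lam (List.finRange n)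
    (List.pairwise_lt_finRange n) x

theorem totalD_inclZero (par : ι → Bool) (d : Module.End R (ι → R)) (u : Fin n → R)
    (x : ι → R) : totalD par d u (inclZero R ι n x) = inclZero R ι n (d x) := by
  refine ext_slice fun J => ?_
  have h₁ : (fun b => totalD par d u (inclZero R ι n x) b J) =
      d (fun b => inclZero R ι n x b J) +
        gX R par (fun b => delK u (inclZero R ι n x b) J) := by
    rw [← oddExt_slice, ← matExt_amat_slice]
    rfl
  have h₂ : (fun b => delK u (inclZero R ι n x b) J) = 0 := by
    funext b
    simp [delK_apply, inclZero]
  rw [h₁, h₂, map_zero, add_zero]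
  by_cases hJ : J = ∅
  · subst hJ
    simp [inclZero]
  · simp [inclZero, hJ, ← Pi.zero_def]

theorem totalD_closedLift {par : ι → Bool} {d : Module.End R (ι → R)} {u : Fin n → R}
    {lam : Fin n → Module.End R (ι → R)} (hd : d * gX R par = -(gX R par * d))
    (hlam_odd : ∀ j, lam j * gX R par = -(gX R par * lam j))
    (hlam : ∀ j, lam j * d + d * lam j = u j • (1 : Module.End R (ι → R))) (x : ι → R) :
    totalD par d u (closedLift par lam x) = (-1 : R) ^ n • closedLift par lam (d x) := by
  have h₁ := list_prod_apply_of_anticomm (D := totalD par d u)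
    ((List.finRange n).map fun j => closedOp par (lam j) j) (by
      simp only [List.mem_map, forall_exists_index, and_imp]
      rintro _ j _ rfl
      exact LinearMap.congr_fun (totalD_mul_closedOp hd (hlam_odd j) (hlam j)))
    (inclZero R ι n x)
  rw [totalD_inclZero, List.length_map, List.length_finRange] at h₁
  exact h₁

theorem epsX_eq (par : ι → Bool) (F : ι → KT R n) :
    epsX R par n F = (gX R par ^ n) (fun b => F b Finset.univ) := rfl

theorem gX_pow_apply_of_anticomm {par : ι → Bool} {d : Module.End R (ι → R)}
    (hd : d * gX R par = -(gX R par * d)) (k : ℕ) (x : ι → R) :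
    (gX R par ^ k) (d x) = (-1 : R) ^ k • d ((gX R par ^ k) x) := by
  have h₁ := list_prod_apply_of_anticomm (D := d) (List.replicate k (gX R par))
    (fun P hP => by
      rw [List.eq_of_mem_replicate hP]
      exact LinearMap.congr_fun hd) x
  rw [List.prod_replicate, List.length_replicate] at h₁
  rw [h₁, smul_smul, ← mul_pow]
  simp

theorem epsX_totalD {par : ι → Bool} {d : Module.End R (ι → R)} (u : Fin n → R)
    (hd : d * gX R par = -(gX R par * d)) (F : ι → KT R n) :
    epsX R par n (totalD par d u F) = (-1 : R) ^ n • d (epsX R par n F) := by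
  have h₁ : (fun b => totalD par d u F b Finset.univ) =
      d (fun b => F b Finset.univ) + gX R par (fun b => delK u (F b) Finset.univ) := by
    rw [← oddExt_slice, ← matExt_amat_slice]
    rfl
  have h₂ : (fun b => delK u (F b) Finset.univ) = 0 := by
    funext b
    simp [delK_apply]
  rw [epsX_eq, epsX_eq, h₁, h₂, map_zero, add_zero]
  exact gX_pow_apply_of_anticomm hd n _

end Total

theorem oddExt_matExt_pow_eq_zero {S R : Type*} [CommRing S] [CommRing R] [Algebra S R] {n : ℕ}
    {κ : Type*} [Fintype κ] [DecidableEq κ] (par : κ → Bool) (d : Module.End R (κ → R))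
    (h : KT R n →ₗ[S] KT R n)
    (hh : ∀ (k : ℕ) (f : KT R n), (∀ I, I.card ≠ k → f I = 0) →
      ∀ J, J.card ≠ k + 1 → h f J = 0) :
    (oddExt S par h *
      ((matExt (amat d) : Module.End R (κ → KT R n)).restrictScalars S)) ^ (n + 1) = 0 := by
  have key : ∀ (m : ℕ) (F : κ → KT R n) (b : κ) (J : Finset (Fin n)), J.card < m →
      ((oddExt S par h *
        ((matExt (amat d) : Module.End R (κ → KT R n)).restrictScalars S)) ^ m) F b J = 0 := by
    intro m
    induction m with
    | zero => simp
    | succ m ih =>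
      intro F b J hJ
      rw [pow_succ', Module.End.mul_apply]
      set F' := ((oddExt S par h *
        ((matExt (amat d) : Module.End R (κ → KT R n)).restrictScalars S)) ^ m) F
      have h₁ : ∀ (c : κ) (I : Finset (Fin n)), I.card < m →
          (matExt (amat d) : Module.End R (κ → KT R n)) F' c I = 0 := fun c I hI => by
        have := congrFun (matExt_amat_slice d F' I) c
        rw [this, show (fun b => F' b I) = 0 from funext fun b => ih F b I hI, map_zero,
          Pi.zero_apply]
      have h₂ := vanish_card_lt_succ h hh (h₁ b) hJ
      rw [Module.End.mul_apply, LinearMap.restrictScalars_apply, oddExt_apply]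
      split <;> simp only [Pi.neg_apply, h₂, neg_zero]
  refine LinearMap.ext fun F => funext fun b => funext fun J => ?_
  exact key _ F b J (Nat.lt_succ_of_le (by simpa using J.card_le_univ))

end Stmt5

open Stmt5 in
theorem statement5
    {S R : Type*} [CommRing S] [CommRing R] [Algebra S R] (W : S) {n : ℕ}
    -- X and Y, finite rank matrix factorisations of φ(W) with homogeneous bases
    {ι : Type*} [Fintype ι] [DecidableEq ι] (par : ι → Bool)
    {κ : Type*} [Fintype κ] [DecidableEq κ] (parY : κ → Bool)
    (dX : Module.End R (ι → R)) (dY : Module.End R (κ → R))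
    (hdX_odd : dX * gX R par = -(gX R par * dX))
    (hdX_sq : dX * dX = algebraMap S R W • (1 : Module.End R (ι → R)))
    (hdY_odd : dY * gX R parY = -(gX R parY * dY))
    (hdY_sq : dY * dY = algebraMap S R W • (1 : Module.End R (κ → R)))
    -- the quasi-regular sequence and the homotopies λⱼ (on X) and μⱼ (on Y)
    (u : Fin n → R) (hqreg : IsQuasiRegular u)
    (lam : Fin n → Module.End R (ι → R))
    (hlam_odd : ∀ j, lam j * gX R par = -(gX R par * lam j))
    (hlam : ∀ j, lam j * dX + dX * lam j = u j • (1 : Module.End R (ι → R)))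
    (mu : Fin n → Module.End R (κ → R))
    (hmu_odd : ∀ j, mu j * gX R parY = -(gX R parY * mu j))
    (hmu : ∀ j, mu j * dY + dY * mu j = u j • (1 : Module.End R (κ → R)))
    -- the deformation retract datum (σ, π, h) over S
    (σ : (R ⧸ Ideal.span (Set.range u)) →ₗ[S] KT R n)
    (h : KT R n →ₗ[S] KT R n)
    (hσ_deg : ∀ x I, I ≠ (∅ : Finset (Fin n)) → σ x I = 0)
    (hh_deg : ∀ (kk : ℕ) (f : KT R n), (∀ I, I.card ≠ kk → f I = 0) →
      ∀ J, J.card ≠ kk + 1 → h f J = 0)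
    (hπσ : ((Submodule.mkQ (Ideal.span (Set.range u))) ∘ₗ
        (LinearMap.proj (∅ : Finset (Fin n)) : KT R n →ₗ[R] R)).restrictScalars S ∘ₗ σ
      = LinearMap.id)
    (hσπ : σ ∘ₗ ((Submodule.mkQ (Ideal.span (Set.range u))) ∘ₗ
        (LinearMap.proj (∅ : Finset (Fin n)) : KT R n →ₗ[R] R)).restrictScalars S
      = LinearMap.id +
        ((delK u).restrictScalars S ∘ₗ h + h ∘ₗ (delK u).restrictScalars S))
    (hh2 : h ∘ₗ h = 0) (hhσ : h ∘ₗ σ = 0)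
    (hπh : ((Submodule.mkQ (Ideal.span (Set.range u))) ∘ₗ
        (LinearMap.proj (∅ : Finset (Fin n)) : KT R n →ₗ[R] R)).restrictScalars S ∘ₗ h
      = 0)
    -- α : X → Y a morphism of matrix factorisations over R
    (α : (ι → R) →ₗ[R] (κ → R))
    (hα_even : gX R parY ∘ₗ α = α ∘ₗ gX R par)
    (hα_chain : dY ∘ₗ α = α ∘ₗ dX) :
    -- notations
    let Q := R ⧸ Ideal.span (Set.range u)
    let σinfY : (κ → Q) →ₗ[S] (κ → KT R n) :=
      ∑ m ∈ Finset.range (n + 1),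
        ((oddExt S parY h *
          ((matExt (amat dY) : Module.End R (κ → KT R n)).restrictScalars S)) ^ m) ∘ₗ
          evExt S σ
    let ψY : (κ → Q) →ₗ[S] (κ → R) := (epsX R parY n).restrictScalars S ∘ₗ σinfY
    let θX : (ι → R) →ₗ[R] (ι → Q) :=
      evExt R (Submodule.mkQ (Ideal.span (Set.range u))) ∘ₗ
        (((-1 : R) ^ n) • ((List.ofFn lam).prod : Module.End R (ι → R)))
    -- ᾱ : X/tX → Y/tY, the reduction of α modulo t
    let αbar : (ι → Q) →ₗ[R] (κ → Q) := matExt (amat α)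
    -- then ψ_Y ∘ ᾱ ∘ θ_X is homotopic over S to α[n]
    ∃ Hm : (ι → R) →ₗ[S] (κ → R),
      ψY ∘ₗ (αbar.restrictScalars S ∘ₗ θX.restrictScalars S) - α.restrictScalars S =
        (((-1 : R) ^ n) • dY).restrictScalars S ∘ₗ Hm +
          Hm ∘ₗ (((-1 : R) ^ n) • dX).restrictScalars S := by
  intro Q σinfY ψY θX αbar
  set E := κ → KT R n
  set q : R →ₗ[R] Q := Submodule.mkQ (Ideal.span (Set.range u))
  set π : KT R n →ₗ[R] Q := q ∘ₗ LinearMap.proj (∅ : Finset (Fin n))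
  let d : Module.End S E := (matExt (amat dY) : Module.End R E).restrictScalars S
  let δ : Module.End S E := oddExt S parY ((delK u).restrictScalars S)
  let h' : Module.End S E := oddExt S parY h
  let p : Module.End S E := evExt S (σ ∘ₗ π.restrictScalars S)
  let G : Module.End S E := ∑ m ∈ Finset.range (n + 1), (h' * d) ^ m
  have hD : d + δ = (totalD parY dY u).restrictScalars S := rfl
  have hdδ : d * δ = -(δ * d) := LinearMap.ext fun F =>
    LinearMap.congr_fun (matExt_oddExt_anticomm hdY_odd (delK u)) F
  have hdd : d * d = W • (1 : Module.End S E) := LinearMap.ext fun F => by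
    have h₁ := (matExt_amat_mul (n := n) dY dY).trans
      ((congrArg (fun z => (matExt (amat z) : Module.End R E)) hdY_sq).trans
        (matExt_amat_smul_one _))
    exact (LinearMap.congr_fun h₁ F).trans (algebraMap_smul R W F)
  have hp : p = 1 + (δ * h' + h' * δ) := by
    rw [Module.End.mul_eq_comp, Module.End.mul_eq_comp, oddExt_oddExt, oddExt_oddExt]
    exact LinearMap.ext fun F => funext fun i => LinearMap.congr_fun hσπ (F i)
  have hhh : h' * h' = 0 := by
    rw [Module.End.mul_eq_comp, oddExt_oddExt, hh2]
    exact LinearMap.ext fun F => rfl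
  have hπh' : ∀ F : E, evExt R π (h' F) = 0 := fun F => funext fun i => by
    have h₁ : π (h (F i)) = 0 := LinearMap.congr_fun hπh (F i)
    change π (h' F i) = 0
    rw [oddExt_apply]
    split <;> simp only [map_neg, h₁, neg_zero]
  have hpdh : p * d * h' = 0 := LinearMap.ext fun F => by
    have h₁ : evExt R π (d (h' F)) = 0 := by
      rw [show d (h' F) = (matExt (amat dY) : Module.End R E) (h' F) from rfl, ← matExt_evExt, hπh',
        map_zero]
    change evExt S σ (evExt R π (d (h' F))) = 0
    rw [h₁, map_zero]
  have hN : (h' * d) ^ (n + 1) = 0 := oddExt_matExt_pow_eq_zero parY dY h hh_deg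
  have hpert : G * p = 1 + ((d + δ) * (G * h') + G * h' * (d + δ)) :=
    perturbation_identity hN hhh hdd ((Commute.one_left h').smul_left W) hdδ hp hpdh
  let Φ : (ι → R) →ₗ[R] E := ((-1 : R) ^ n) • (matExt (amat α) ∘ₗ closedLift par lam)
  have hΦ_slice : ∀ x J, (fun b => Φ x b J) =
      ((-1 : R) ^ n) • α (fun b => closedLift par lam x b J) := fun x J => by
    rw [← matExt_amat_slice]
    rfl
  have hαD : ∀ F : ι → KT R n, totalD parY dY u (matExt (amat α) F) =
      matExt (amat α) (totalD par dX u F) := fun F => by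
    simp only [totalD, LinearMap.add_apply, map_add, oddExt_eq, Module.End.mul_apply, matExt_evExt]
    congr 1
    · refine ext_slice fun J => ?_
      simp only [matExt_amat_slice]
      exact LinearMap.congr_fun hα_chain _
    · congr 1
      refine ext_slice fun J => ?_
      simp only [matExt_amat_slice]
      exact LinearMap.congr_fun hα_even _
  have hΦD : ∀ x, totalD parY dY u (Φ x) = Φ (((-1 : R) ^ n) • dX x) := fun x => by
    simp only [Φ, LinearMap.smul_apply, LinearMap.comp_apply, map_smul, hαD,
      totalD_closedLift hdX_odd hlam_odd hlam]
  have hα_pow : ∀ (k : ℕ) (x : ι → R), (gX R parY ^ k) (α x) = α ((gX R par ^ k) x) := fun k => by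
    induction k with
    | zero => simp
    | succ k ih =>
      intro x
      rw [pow_succ, pow_succ, Module.End.mul_apply, Module.End.mul_apply, ← ih]
      exact congrArg _ (LinearMap.congr_fun hα_even x)
  have hΦε : ∀ x, epsX R parY n (Φ x) = α x := fun x => by
    rw [epsX_eq, hΦ_slice, closedLift_slice_univ, map_smul, map_smul, map_smul, hα_pow, smul_smul,
      ← mul_pow, ← Module.End.mul_apply, gX_pow_mul_pow]
    simp
  have hΦπ : ∀ x, evExt R π (Φ x) = αbar (θX x) := fun x => by
    have h₁ : evExt R π (Φ x) = evExt R q (fun b => Φ x b ∅) := rfl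
    rw [h₁, hΦ_slice, closedLift_slice_empty, ← map_smul, ← matExt_amat_self α, ← matExt_evExt]
    rfl
  refine ⟨(epsX R parY n).restrictScalars S ∘ₗ (G * h') ∘ₗ Φ.restrictScalars S,
    LinearMap.ext fun x => ?_⟩
  have hψ : ψY (αbar (θX x)) = epsX R parY n ((G * p) (Φ x)) := by
    have h₁ : σinfY (evExt R π (Φ x)) = (G * p) (Φ x) := by
      simp only [σinfY, G, LinearMap.sum_apply, Module.End.mul_apply]
      rfl
    rw [← h₁, hΦπ]
    rfl
  have h₁ := LinearMap.congr_fun hpert (Φ x)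
  change ψY (αbar (θX x)) - α x = ((-1 : R) ^ n) • dY (epsX R parY n ((G * h') (Φ x))) +
    epsX R parY n ((G * h') (Φ (((-1 : R) ^ n) • dX x)))
  rw [hψ, h₁, ← epsX_totalD u hdY_odd, ← hΦD, ← hΦε x, hD]
  simp only [LinearMap.add_apply, Module.End.mul_apply, Module.End.one_apply, map_add,
    LinearMap.restrictScalars_apply]
  abel
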